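/- arXiv:1405.1133 — 4 statements merged into one kernel-verified Lean document; each statement's English description precedes it below -/
import Mathlib

section
/- Let (H,w) be a weighted hypergraph with dimension d > 0, n ≥ 3 vertices and m edges, and all edge weights positive. For any 0 < p ≤ 1 and any real δ > 1, when each vertex is marked independently with probability p, Pr[S(H,w,p) > k(H)·D(H,w,p)] < p(H), where k(H) = (log₂ n + 2)^(2^d − 1) · δ^(2^(d−1)) and p(H) = (2^d · ⌈log₂ n⌉ · m)^(d−1) · (log₂ n) · (4e/(δ−1))^((δ−1)/4). -/
open Finset

/-- The probability weight of a marking outcome `ω`, when each vertex is marked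
independently with probability `p`. -/
noncomputable def markWeight {V : Type} [Fintype V] (p : ℝ) (ω : V → Bool) : ℝ :=
  ∏ v, if ω v then p else 1 - p

open Classical in
/-- The probability of the event `A` under independent `Bernoulli(p)` marking of
the vertices. -/
noncomputable def markPr {V : Type} [Fintype V] (p : ℝ) (A : (V → Bool) → Prop) : ℝ :=
  ∑ ω : V → Bool, if A ω then markWeight p ω else 0

/-- `S(H,w,p)` evaluated at a marking `ω`: the total weight of fully marked edges. -/
noncomputable def Sval {V : Type} (E : Finset (Finset V)) (w : Finset V → ℝ)
    (ω : V → Bool) : ℝ :=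
  ∑ e ∈ E, w e * ∏ v ∈ e, (if ω v then (1 : ℝ) else 0)

/-- `P(H,w,p,x) = Σ_{e ∈ E, x ⊆ e} w(e)·p^(|e|−|x|)`. -/
noncomputable def Pval {V : Type} [DecidableEq V] (E : Finset (Finset V))
    (w : Finset V → ℝ) (p : ℝ) (x : Finset V) : ℝ :=
  ∑ e ∈ E.filter (fun e => x ⊆ e), w e * p ^ (e.card - x.card)

/-- `D(H,w,p) = max_{x ⊆ V} P(H,w,p,x)`. -/
noncomputable def Dval {V : Type} [Fintype V] [DecidableEq V] (E : Finset (Finset V))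
    (w : Finset V → ℝ) (p : ℝ) : ℝ :=
  Finset.univ.sup' Finset.univ_nonempty (fun x : Finset V => Pval E w p x)

theorem markWeight_nonneg {V : Type} [Fintype V] {p : ℝ} (hp0 : 0 ≤ p) (hp1 : p ≤ 1)
    (ω : V → Bool) : 0 ≤ markWeight p ω :=
  prod_nonneg fun v _ => by split_ifs <;> linarith

/-- The probability that all vertices of `U` are marked is `p ^ |U|`. -/
theorem sum_markWeight_mul_prod {V : Type} [Fintype V] [DecidableEq V] (p : ℝ) (U : Finset V) :
    ∑ ω : V → Bool, markWeight p ω * ∏ v ∈ U, (if ω v then (1 : ℝ) else 0) = p ^ U.card := by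
  have h1 : ∀ ω : V → Bool, markWeight p ω * ∏ v ∈ U, (if ω v then (1 : ℝ) else 0) =
      ∏ v, (if ω v then p else if v ∈ U then 0 else 1 - p) := by
    intro ω
    rw [markWeight, ← Fintype.prod_ite_mem U, ← prod_mul_distrib]
    refine prod_congr rfl fun v _ => ?_
    by_cases hv : v ∈ U <;> by_cases ho : ω v <;> simp [hv, ho]
  simp_rw [h1]
  have h2 := Fintype.prod_sum
    (fun (v : V) (b : Bool) => if b then p else if v ∈ U then (0 : ℝ) else 1 - p)
  rw [← h2, ← prod_const, ← Fintype.prod_ite_mem U]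
  refine prod_congr rfl fun v _ => ?_
  by_cases hv : v ∈ U <;> simp [hv]

theorem sum_markWeight {V : Type} [Fintype V] [DecidableEq V] (p : ℝ) :
    ∑ ω : V → Bool, markWeight p ω = 1 := by
  simpa using sum_markWeight_mul_prod p (∅ : Finset V)

theorem prod_ite_mul_prod_ite {V : Type} [DecidableEq V] (ω : V → Bool) (U e : Finset V) :
    (∏ v ∈ U, (if ω v then (1 : ℝ) else 0)) * ∏ v ∈ e, (if ω v then (1 : ℝ) else 0) =
      ∏ v ∈ U ∪ e, (if ω v then (1 : ℝ) else 0) := by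
  simp only [prod_boole, mem_union, or_imp, forall_and, mul_ite, mul_one, mul_zero, ← ite_and,
    and_comm]

/-- A set of `N` elements has at most `(N + 1) ^ d` subsets of size at most `d`. -/
theorem card_powerset_filter_card_le {V : Type} [DecidableEq V] (U : Finset V) (d : ℕ) :
    (U.powerset.filter fun x => x.card ≤ d).card ≤ (U.card + 1) ^ d := by
  have hsub : (U.powerset.filter fun x => x.card ≤ d) ⊆
      (range (d + 1)).biUnion fun i => U.powersetCard i := by
    intro x hx
    simp only [mem_filter, mem_powerset] at hx
    simp only [mem_biUnion, mem_range, mem_powersetCard]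
    exact ⟨x.card, by omega, hx.1, rfl⟩
  refine (card_le_card hsub).trans (card_biUnion_le.trans ?_)
  rw [add_pow]
  refine sum_le_sum fun i hi => ?_
  rw [card_powersetCard, one_pow, mul_one]
  have hpos : 0 < d.choose i := Nat.choose_pos (by simpa [Nat.lt_succ_iff] using hi)
  exact (Nat.choose_le_pow _ _).trans (Nat.le_mul_of_pos_right _ hpos)

theorem Pval_le_Dval {V : Type} [Fintype V] [DecidableEq V] (E : Finset (Finset V))
    (w : Finset V → ℝ) (p : ℝ) (x : Finset V) : Pval E w p x ≤ Dval E w p :=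
  le_sup' (fun x : Finset V => Pval E w p x) (mem_univ x)

theorem weight_le_Dval {V : Type} [Fintype V] [DecidableEq V] {E : Finset (Finset V)}
    {w : Finset V → ℝ} (hw : ∀ e ∈ E, 0 < w e) {p : ℝ} (hp : 0 ≤ p) {e : Finset V}
    (he : e ∈ E) : w e ≤ Dval E w p := by
  refine le_trans ?_ (Pval_le_Dval E w p e)
  have h := single_le_sum (f := fun e' : Finset V => w e' * p ^ (e'.card - e.card))
    (s := E.filter fun e' => e ⊆ e')
    (fun i hi => mul_nonneg (hw i (mem_filter.1 hi).1).le (pow_nonneg hp _))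
    (mem_filter.2 ⟨he, subset_rfl⟩)
  simpa [Pval] using h

theorem Sval_nonneg {V : Type} {E : Finset (Finset V)} {w : Finset V → ℝ}
    (hw : ∀ e ∈ E, 0 < w e) (ω : V → Bool) : 0 ≤ Sval E w ω :=
  sum_nonneg fun e he => mul_nonneg (hw e he).le
    (prod_nonneg fun v _ => by split_ifs <;> norm_num)

theorem Sval_le_card_mul_Dval {V : Type} [Fintype V] [DecidableEq V] {E : Finset (Finset V)}
    {w : Finset V → ℝ} (hw : ∀ e ∈ E, 0 < w e) {p : ℝ} (hp : 0 ≤ p) (ω : V → Bool) :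
    Sval E w ω ≤ E.card * Dval E w p := by
  rw [← nsmul_eq_mul]
  refine sum_le_card_nsmul _ _ _ fun e he => ?_
  refine le_trans ?_ (weight_le_Dval hw hp he)
  refine mul_le_of_le_one_right (hw e he).le ?_
  exact prod_le_one (fun v _ => by split_ifs <;> norm_num) fun v _ => by split_ifs <;> norm_num

/-- The expected weight of marked edges, given that the vertices of `U` are marked. -/
theorem sum_weight_mul_pow_card_union_le {V : Type} [Fintype V] [DecidableEq V]
    {E : Finset (Finset V)} {w : Finset V → ℝ} {d : ℕ} (hd : ∀ e ∈ E, e.card ≤ d)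
    (hw : ∀ e ∈ E, 0 < w e) {p : ℝ} (hp : 0 ≤ p) (hD : 0 ≤ Dval E w p) (U : Finset V) :
    ∑ e ∈ E, w e * p ^ (U ∪ e).card ≤
      p ^ U.card * (Dval E w p * ((U.card : ℝ) + 1) ^ d) := by
  have h1 : ∀ e ∈ E, w e * p ^ (U ∪ e).card =
      p ^ U.card * (w e * p ^ (e.card - (e ∩ U).card)) := by
    intro e _
    have h2 : (U ∪ e).card = U.card + (e.card - (e ∩ U).card) := by
      have := card_union_add_card_inter U e
      have h3 := card_le_card (inter_subset_left : e ∩ U ⊆ e)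
      rw [inter_comm] at this
      omega
    rw [h2, pow_add]
    ring
  rw [sum_congr rfl h1, ← mul_sum]
  refine mul_le_mul_of_nonneg_left ?_ (pow_nonneg hp _)
  have hmaps : ∀ e ∈ E, e ∩ U ∈ U.powerset.filter fun x => x.card ≤ d := fun e he =>
    mem_filter.2 ⟨mem_powerset.2 inter_subset_right,
      (card_le_card inter_subset_left).trans (hd e he)⟩
  rw [← sum_fiberwise_of_maps_to hmaps]
  have hfib : ∀ x ∈ U.powerset.filter (fun x => x.card ≤ d),
      ∑ e ∈ E with e ∩ U = x, w e * p ^ (e.card - (e ∩ U).card) ≤ Dval E w p := by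
    intro x _
    refine le_trans ?_ (Pval_le_Dval E w p x)
    rw [Pval]
    calc _ = ∑ e ∈ E with e ∩ U = x, w e * p ^ (e.card - x.card) :=
          sum_congr rfl fun e he => by rw [(mem_filter.1 he).2]
      _ ≤ _ := by
          refine sum_le_sum_of_subset_of_nonneg ?_ fun e he _ =>
            mul_nonneg (hw e (mem_filter.1 he).1).le (pow_nonneg hp _)
          intro e he
          obtain ⟨he1, rfl⟩ := mem_filter.1 he
          exact mem_filter.2 ⟨he1, inter_subset_left⟩
  refine (sum_le_card_nsmul _ _ _ hfib).trans ?_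
  rw [nsmul_eq_mul, mul_comm]
  refine mul_le_mul_of_nonneg_left ?_ hD
  exact_mod_cast card_powerset_filter_card_le U d

theorem sum_markWeight_mul_prod_mul_Sval_pow_le {V : Type} [Fintype V] [DecidableEq V]
    {E : Finset (Finset V)} {w : Finset V → ℝ} {d : ℕ} (hdpos : 0 < d)
    (hd : ∀ e ∈ E, e.card ≤ d) (hw : ∀ e ∈ E, 0 < w e) {p : ℝ} (hp : 0 ≤ p)
    (hD : 0 ≤ Dval E w p) (R r : ℕ) :
    ∀ U : Finset V, U.card + r * d ≤ R * d →
      ∑ ω : V → Bool, markWeight p ω *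
        ((∏ v ∈ U, (if ω v then (1 : ℝ) else 0)) * Sval E w ω ^ r) ≤
      p ^ U.card * (Dval E w p * ((R : ℝ) * d) ^ d) ^ r := by
  induction r with
  | zero =>
    intro U _
    simp only [pow_zero, mul_one]
    exact (sum_markWeight_mul_prod p U).le
  | succ r ih =>
    intro U hU
    have hC : 0 ≤ Dval E w p * ((R : ℝ) * d) ^ d := by positivity
    have hexp : ∀ ω : V → Bool, markWeight p ω *
        ((∏ v ∈ U, (if ω v then (1 : ℝ) else 0)) * Sval E w ω ^ (r + 1)) =
        ∑ e ∈ E, w e * (markWeight p ω *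
          ((∏ v ∈ U ∪ e, (if ω v then (1 : ℝ) else 0)) * Sval E w ω ^ r)) := by
      intro ω
      rw [pow_succ]
      nth_rewrite 2 [Sval]
      simp only [mul_sum]
      refine sum_congr rfl fun e _ => ?_
      rw [← prod_ite_mul_prod_ite]
      ring
    simp_rw [hexp]
    rw [sum_comm]
    simp_rw [← mul_sum]
    have hUR : U.card + d + r * d ≤ R * d := by linarith [Nat.succ_mul r d]
    have hUR1 : U.card + 1 ≤ R * d := by nlinarith [Nat.zero_le (r * d)]
    calc _ ≤ ∑ e ∈ E, w e *
          (p ^ (U ∪ e).card * (Dval E w p * ((R : ℝ) * d) ^ d) ^ r) := by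
          refine sum_le_sum fun e he => mul_le_mul_of_nonneg_left (ih _ ?_) (hw e he).le
          have := card_union_le U e
          have := hd e he
          omega
      _ = (∑ e ∈ E, w e * p ^ (U ∪ e).card) * (Dval E w p * ((R : ℝ) * d) ^ d) ^ r := by
          rw [sum_mul]
          exact sum_congr rfl fun e _ => by ring
      _ ≤ (p ^ U.card * (Dval E w p * ((R : ℝ) * d) ^ d)) *
            (Dval E w p * ((R : ℝ) * d) ^ d) ^ r := by
          refine mul_le_mul_of_nonneg_right ?_ (pow_nonneg hC _)
          refine (sum_weight_mul_pow_card_union_le hd hw hp hD U).trans ?_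
          have : (U.card : ℝ) + 1 ≤ R * d := by exact_mod_cast hUR1
          gcongr
      _ = _ := by ring

/-- The moment bound `E[S ^ r] ≤ (D · (r d) ^ d) ^ r`. -/
theorem sum_markWeight_mul_Sval_pow_le {V : Type} [Fintype V] [DecidableEq V]
    {E : Finset (Finset V)} {w : Finset V → ℝ} {d : ℕ} (hdpos : 0 < d)
    (hd : ∀ e ∈ E, e.card ≤ d) (hw : ∀ e ∈ E, 0 < w e) {p : ℝ} (hp : 0 ≤ p)
    (hD : 0 ≤ Dval E w p) (r : ℕ) :
    ∑ ω : V → Bool, markWeight p ω * Sval E w ω ^ r ≤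
      (Dval E w p * ((r : ℝ) * d) ^ d) ^ r := by
  simpa using sum_markWeight_mul_prod_mul_Sval_pow_le hdpos hd hw hp hD r r ∅ (by simp)

open Classical in
theorem markPr_eq_sum {V : Type} [Fintype V] [DecidableEq V] (p : ℝ) (A : (V → Bool) → Prop) :
    markPr p A = ∑ ω : V → Bool, if A ω then markWeight p ω else 0 := by
  rw [markPr]
  congr!

theorem markPr_le_one {V : Type} [Fintype V] [DecidableEq V] {p : ℝ} (hp0 : 0 ≤ p)
    (hp1 : p ≤ 1) (A : (V → Bool) → Prop) : markPr p A ≤ 1 := by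
  rw [← sum_markWeight (V := V) p, markPr_eq_sum]
  refine sum_le_sum fun ω _ => ?_
  split_ifs
  · exact le_rfl
  · exact markWeight_nonneg hp0 hp1 ω

theorem markPr_eq_zero {V : Type} [Fintype V] (p : ℝ) {A : (V → Bool) → Prop}
    (hA : ∀ ω, ¬ A ω) : markPr p A = 0 := by
  simp [markPr, hA]

/-- Markov's inequality for the `r`-th power of a nonnegative random variable. -/
theorem markPr_mul_pow_le {V : Type} [Fintype V] [DecidableEq V] {p : ℝ} (hp0 : 0 ≤ p) (hp1 : p ≤ 1)
    {X : (V → Bool) → ℝ} (hX : ∀ ω, 0 ≤ X ω) {t : ℝ} (ht : 0 ≤ t) (r : ℕ) :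
    markPr p (fun ω => X ω > t) * t ^ r ≤ ∑ ω : V → Bool, markWeight p ω * X ω ^ r := by
  rw [markPr_eq_sum, sum_mul]
  refine sum_le_sum fun ω _ => ?_
  split_ifs with h
  · exact mul_le_mul_of_nonneg_left (pow_le_pow_left₀ ht (le_of_lt h) r)
      (markWeight_nonneg hp0 hp1 ω)
  · rw [zero_mul]
    exact mul_nonneg (markWeight_nonneg hp0 hp1 ω) (pow_nonneg (hX ω) r)

theorem markPr_Sval_le_half_pow {V : Type} [Fintype V] [DecidableEq V]
    {E : Finset (Finset V)} {w : Finset V → ℝ} {d : ℕ} (hdpos : 0 < d)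
    (hd : ∀ e ∈ E, e.card ≤ d) (hw : ∀ e ∈ E, 0 < w e) {p : ℝ} (hp0 : 0 ≤ p) (hp1 : p ≤ 1)
    (hD : 0 < Dval E w p) {r : ℕ} {k : ℝ} (hk0 : 0 < k) (hk : 2 * ((r : ℝ) * d) ^ d ≤ k) :
    markPr p (fun ω => Sval E w ω > k * Dval E w p) ≤ (1 / 2) ^ r := by
  have hpos : 0 < (k * Dval E w p) ^ r := by positivity
  refine le_of_mul_le_mul_right ?_ hpos
  refine (markPr_mul_pow_le hp0 hp1 (Sval_nonneg hw) (by positivity) r).trans ?_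
  refine (sum_markWeight_mul_Sval_pow_le hdpos hd hw hp0 hD.le r).trans ?_
  rw [← mul_pow]
  refine pow_le_pow_left₀ (by positivity) ?_ r
  nlinarith

theorem mul_self_add_two_le_two_pow_add {d : ℕ} (hd : 0 < d) : d * d + 2 ≤ 2 ^ d + 2 * d := by
  rcases Nat.lt_or_ge d 4 with h | h
  · interval_cases d <;> norm_num
  · clear hd
    induction d, h using Nat.le_induction with
    | base => norm_num
    | succ n hn ih =>
      rw [pow_succ]
      nlinarith

theorem two_mul_pow_self_le {d : ℕ} (hd : 0 < d) :
    2 * d ^ d ≤ 4 ^ d * 2 ^ (2 ^ d - 1 - d) := by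
  obtain ⟨c, rfl⟩ : ∃ c, d = c + 1 := ⟨d - 1, by omega⟩
  have h1 : c + 1 ≤ 2 ^ c := Nat.lt_two_pow_self
  have h2 := mul_self_add_two_le_two_pow_add hd
  have h3 : c + 1 < 2 ^ (c + 1) := Nat.lt_two_pow_self
  have h4 : c * (c + 1) + 1 ≤ 2 * (c + 1) + (2 ^ (c + 1) - 1 - (c + 1)) := by
    have : (c + 1) * (c + 1) = c * (c + 1) + (c + 1) := by ring
    omega
  calc 2 * (c + 1) ^ (c + 1) ≤ 2 * (2 ^ c) ^ (c + 1) := by gcongr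
    _ = 2 ^ (c * (c + 1) + 1) := by rw [← pow_mul, pow_succ, mul_comm]
    _ ≤ 2 ^ (2 * (c + 1) + (2 ^ (c + 1) - 1 - (c + 1))) := Nat.pow_le_pow_right (by norm_num) h4
    _ = _ := by rw [pow_add, pow_mul]; norm_num

theorem le_two_pow_pred {d : ℕ} (hd : 0 < d) : d ≤ 2 ^ (d - 1) := by
  have : d - 1 < 2 ^ (d - 1) := Nat.lt_two_pow_self
  omega

theorem two_mul_pow_le_of_le {d : ℕ} (hd : 0 < d) {L δ r : ℝ} (hL : 0 ≤ L) (hδ : 1 ≤ δ)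
    (hr0 : 0 ≤ r) (hr : 4 * r ≤ (L + 2) * δ) :
    2 * (r * d) ^ d ≤ (L + 2) ^ (2 ^ d - 1) * δ ^ (2 ^ (d - 1)) := by
  have h1 : (2 : ℝ) * (d : ℝ) ^ d ≤ 4 ^ d * 2 ^ (2 ^ d - 1 - d) := by
    exact_mod_cast two_mul_pow_self_le hd
  have h2 : d < 2 ^ d := Nat.lt_two_pow_self
  have h3 : (2 : ℝ) ^ (2 ^ d - 1 - d) ≤ (L + 2) ^ (2 ^ d - 1 - d) :=
    pow_le_pow_left₀ (by norm_num) (by linarith) _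
  have h4 : δ ^ d ≤ δ ^ (2 ^ (d - 1)) := pow_le_pow_right₀ hδ (le_two_pow_pred hd)
  have h5 : (L + 2) ^ (2 ^ d - 1) = (L + 2) ^ d * (L + 2) ^ (2 ^ d - 1 - d) := by
    rw [← pow_add]
    congr 1
    omega
  have h6 : (0 : ℝ) < 4 ^ d := by positivity
  refine le_of_mul_le_mul_left ?_ h6
  calc (4 : ℝ) ^ d * (2 * (r * d) ^ d) = (4 * r) ^ d * (2 * (d : ℝ) ^ d) := by
        simp only [mul_pow]; ring
    _ ≤ ((L + 2) * δ) ^ d * (4 ^ d * (L + 2) ^ (2 ^ d - 1 - d)) := by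
        refine mul_le_mul (pow_le_pow_left₀ (by positivity) hr d) (h1.trans ?_)
          (by positivity) (by positivity)
        gcongr
    _ = 4 ^ d * ((L + 2) ^ (2 ^ d - 1) * δ ^ d) := by rw [h5, mul_pow]; ring
    _ ≤ _ := by gcongr

theorem lt_of_mul_pow_lt_card {V : Type} [Fintype V] [DecidableEq V] [Nonempty V]
    {E : Finset (Finset V)} {d : ℕ} (hdpos : 0 < d) (hd : ∀ e ∈ E, e.card ≤ d) {L δ : ℝ}
    (hL : 0 ≤ L) (hδ : 1 ≤ δ)
    (h : (L + 2) ^ (2 ^ d - 1) * δ ^ (2 ^ (d - 1)) < E.card) : δ < Fintype.card V := by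
  have hcard : (E.card : ℝ) ≤ ((Fintype.card V : ℝ) + 1) ^ d := by
    have h1 : E ⊆ (univ : Finset V).powerset.filter fun x => x.card ≤ d := fun e he =>
      mem_filter.2 ⟨mem_powerset.2 (subset_univ _), hd e he⟩
    exact_mod_cast (card_le_card h1).trans (card_powerset_filter_card_le univ d)
  have hn : (1 : ℝ) ≤ Fintype.card V := by exact_mod_cast Fintype.card_pos (α := V)
  have h2 : d < 2 ^ d := Nat.lt_two_pow_self
  have h3 : (2 : ℝ) ^ d ≤ (L + 2) ^ (2 ^ d - 1) :=
    (pow_le_pow_left₀ (by norm_num) (by linarith : (2 : ℝ) ≤ L + 2) d).trans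
      (pow_le_pow_right₀ (by linarith) (by omega))
  have h4 : δ ^ d ≤ δ ^ (2 ^ (d - 1)) := pow_le_pow_right₀ hδ (le_two_pow_pred hdpos)
  have h5 : (2 * δ) ^ d < (2 * (Fintype.card V : ℝ)) ^ d := by
    calc (2 * δ) ^ d = 2 ^ d * δ ^ d := mul_pow _ _ _
      _ ≤ (L + 2) ^ (2 ^ d - 1) * δ ^ (2 ^ (d - 1)) := by gcongr
      _ < _ := h
      _ ≤ _ := hcard
      _ ≤ _ := pow_le_pow_left₀ (by positivity) (by linarith) d
  have := lt_of_pow_lt_pow_left₀ d (by positivity) h5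
  linarith

/-- Theorem 1 in Kelsen: for a weighted hypergraph `(H,w)` of dimension
`d > 0` with `n ≥ 3` vertices, `m` edges and positive weights, for `0 < p ≤ 1` and `δ > 1`,
`Pr[S(H,w,p) > k(H)·D(H,w,p)] < p(H)` with
`k(H) = (log₂ n + 2)^(2^d−1)·δ^(2^(d−1))` and
`p(H) = (2^d·⌈log₂ n⌉·m)^(d−1)·(log₂ n)·(4e/(δ−1))^((δ−1)/4)`. -/
theorem stmt0 {V : Type} [Fintype V] [DecidableEq V]
    (E : Finset (Finset V)) (w : Finset V → ℝ) (d : ℕ)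
    (hEne : ∀ e ∈ E, e.Nonempty)
    (hdpos : 0 < d)
    (hdim : (∀ e ∈ E, e.card ≤ d) ∧ ∃ e ∈ E, e.card = d)
    (hn : 3 ≤ Fintype.card V)
    (hw : ∀ e ∈ E, 0 < w e)
    (p δ : ℝ) (hp0 : 0 < p) (hp1 : p ≤ 1) (hδ : 1 < δ) :
    markPr p (fun ω =>
        Sval E w ω >
          ((Real.logb 2 (Fintype.card V) + 2) ^ (2 ^ d - 1) * δ ^ (2 ^ (d - 1))) *
            Dval E w p)
      < ((2 : ℝ) ^ d * (⌈Real.logb 2 (Fintype.card V)⌉ : ℝ) * (E.card : ℝ)) ^ (d - 1) *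
          Real.logb 2 (Fintype.card V) *
          (4 * Real.exp 1 / (δ - 1)) ^ ((δ - 1) / 4) := by
  set L : ℝ := Real.logb 2 (Fintype.card V) with hLdef
  set k : ℝ := (L + 2) ^ (2 ^ d - 1) * δ ^ (2 ^ (d - 1)) with hkdef
  set y : ℝ := (δ - 1) / 4 with hy
  set B : ℝ := (4 * Real.exp 1 / (δ - 1)) ^ y with hB
  have hn3 : (3 : ℝ) ≤ Fintype.card V := by exact_mod_cast hn
  have hL1 : 1 < L := by
    rw [hLdef, Real.lt_logb_iff_rpow_lt (by norm_num) (by linarith), Real.rpow_one]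
    linarith
  obtain ⟨e, heE, -⟩ := hdim.2
  have hD : 0 < Dval E w p := (hw e heE).trans_le (weight_le_Dval hw hp0.le heE)
  have hypos : 0 < y := by rw [hy]; linarith
  have hBpos : 0 < B :=
    Real.rpow_pos_of_pos (div_pos (by positivity) (by linarith)) _
  have hprefactor : 1 ≤ ((2 : ℝ) ^ d * (⌈L⌉ : ℝ) * (E.card : ℝ)) ^ (d - 1) := by
    have hE1 : (1 : ℝ) ≤ E.card := by exact_mod_cast card_pos.2 ⟨e, heE⟩
    refine one_le_pow₀ (one_le_mul_of_one_le_of_one_le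
      (one_le_mul_of_one_le_of_one_le (one_le_pow₀ (by norm_num)) ?_) hE1)
    exact hL1.le.trans (Int.le_ceil L)
  have hBlt : B < ((2 : ℝ) ^ d * (⌈L⌉ : ℝ) * (E.card : ℝ)) ^ (d - 1) * L * B := by
    have h1 : 1 < ((2 : ℝ) ^ d * (⌈L⌉ : ℝ) * (E.card : ℝ)) ^ (d - 1) * L := by nlinarith
    nlinarith
  refine lt_of_le_of_lt ?_ hBlt
  have hexp : 1 ≤ Real.exp 1 := Real.one_le_exp zero_le_one
  rcases le_or_gt δ 2 with hδ2 | hδ2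
  · refine (markPr_le_one hp0.le hp1 _).trans (Real.one_le_rpow ?_ hypos.le)
    rw [le_div_iff₀ (by linarith)]
    linarith
  have hk0 : 0 < k := by positivity
  rcases le_or_gt (E.card : ℝ) k with hmk | hmk
  · refine (markPr_eq_zero p fun ω => ?_).le.trans hBpos.le
    exact not_lt.2 ((Sval_le_card_mul_Dval hw hp0.le ω).trans
      (mul_le_mul_of_nonneg_right hmk hD.le))
  have : Nonempty V := Fintype.card_pos_iff.1 (by omega)
  have hδn : δ < Fintype.card V :=
    lt_of_mul_pow_lt_card hdpos hdim.1 (by linarith) hδ.le hmk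
  have hceil : (⌈L * y⌉₊ : ℝ) < L * y + 1 := Nat.ceil_lt_add_one (by positivity)
  have hk : 2 * ((⌈L * y⌉₊ : ℝ) * d) ^ d ≤ k := by
    refine two_mul_pow_le_of_le hdpos (by linarith) hδ.le (by positivity) ?_
    have : 4 * (L * y) = L * δ - L := by rw [hy]; ring
    nlinarith
  refine (markPr_Sval_le_half_pow hdpos hdim.1 hw hp0.le hp1 hD hk0 hk).trans ?_
  calc ((1 : ℝ) / 2) ^ ⌈L * y⌉₊ = (1 / 2 : ℝ) ^ (⌈L * y⌉₊ : ℝ) := (Real.rpow_natCast _ _).symm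
    _ ≤ (1 / 2 : ℝ) ^ (L * y) :=
        Real.rpow_le_rpow_of_exponent_ge (by norm_num) (by norm_num) (Nat.le_ceil _)
    _ = ((1 : ℝ) / Fintype.card V) ^ y := by
        rw [Real.rpow_mul (by norm_num), Real.div_rpow (by norm_num) (by norm_num),
          Real.one_rpow, hLdef, Real.rpow_logb (by norm_num) (by norm_num) (by linarith)]
    _ ≤ B := by
        refine Real.rpow_le_rpow (by positivity) ?_ hypos.le
        rw [div_le_div_iff₀ (by linarith) (by linarith)]
        nlinarith
end

section
/- Let H = (V,E) be a hypergraph of dimension d ≥ 2, let X ⊆ V be nonempty, and let 1 ≤ j < k ≤ d − |X|. Let H' be the hypergraph on vertex set V with edge set X_{j,k} = {Y ⊆ V : |Y| = k−j and Y ⊆ Z for some Z ∈ N_k(X,H)} and weights w'(Y) = |N_j(X∪Y,H)|, and let p = 1/(2^{d+1}·Δ(H)). Then D(H',w',p) ≤ (Δ_{|X|+k}(H))^j. -/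
open Finset

/-- `N_j(x,H) = {y ⊆ V : x ∪ y ∈ E, x ∩ y = ∅, |y| = j}`. -/
def Nset {V : Type} [Fintype V] [DecidableEq V] (E : Finset (Finset V))
    (x : Finset V) (j : ℕ) : Finset (Finset V) :=
  Finset.univ.filter (fun y => x ∪ y ∈ E ∧ x ∩ y = ∅ ∧ y.card = j)

/-- The normalized degree `d_j(x,H) = |N_j(x,H)|^(1/j)`. -/
noncomputable def dDeg {V : Type} [Fintype V] [DecidableEq V] (E : Finset (Finset V))
    (x : Finset V) (j : ℕ) : ℝ :=
  ((Nset E x j).card : ℝ) ^ (1 / (j : ℝ))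

/-- `Δ_i(H) = max{d_{i−|x|}(x,H) : x ⊆ V, 0 < |x| < i}`. -/
noncomputable def DeltaI {V : Type} [Fintype V] [DecidableEq V] (E : Finset (Finset V))
    (i : ℕ) : ℝ :=
  sSup {r : ℝ | ∃ x : Finset V, 0 < x.card ∧ x.card < i ∧ r = dDeg E x (i - x.card)}

/-- `Δ(H) = max{Δ_i(H) : 2 ≤ i ≤ d}`. -/
noncomputable def Delta {V : Type} [Fintype V] [DecidableEq V] (E : Finset (Finset V))
    (d : ℕ) : ℝ :=
  sSup {r : ℝ | ∃ i : ℕ, 2 ≤ i ∧ i ≤ d ∧ r = DeltaI E i}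

section Aux

variable {V : Type} [Fintype V] [DecidableEq V] (E : Finset (Finset V))

lemma mem_Nset {E : Finset (Finset V)} {x y : Finset V} {j : ℕ} :
    y ∈ Nset E x j ↔ x ∪ y ∈ E ∧ x ∩ y = ∅ ∧ y.card = j := by
  simp [Nset]

lemma dDeg_nonneg (x : Finset V) (j : ℕ) : 0 ≤ dDeg E x j := by
  unfold dDeg; positivity

lemma dDeg_le_DeltaI {x : Finset V} {i : ℕ} (h0 : 0 < x.card) (hi : x.card < i) :
    dDeg E x (i - x.card) ≤ DeltaI E i := by
  refine le_csSup ?_ ⟨x, h0, hi, rfl⟩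
  refine ((Set.finite_range fun x : Finset V => dDeg E x (i - x.card)).subset ?_).bddAbove
  rintro _ ⟨y, -, -, rfl⟩
  exact ⟨y, rfl⟩

lemma DeltaI_nonneg (i : ℕ) : 0 ≤ DeltaI E i := by
  refine Real.sSup_nonneg ?_
  rintro _ ⟨y, -, -, rfl⟩
  exact dDeg_nonneg E y _

lemma DeltaI_le_Delta {i d : ℕ} (h2 : 2 ≤ i) (hi : i ≤ d) : DeltaI E i ≤ Delta E d := by
  refine le_csSup ?_ ⟨i, h2, hi, rfl⟩
  refine (((Set.finite_Icc 2 d).image (DeltaI E)).subset ?_).bddAbove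
  rintro _ ⟨i, h2, hi, rfl⟩
  exact ⟨i, ⟨h2, hi⟩, rfl⟩

lemma Delta_nonneg (d : ℕ) : 0 ≤ Delta E d := by
  refine Real.sSup_nonneg ?_
  rintro _ ⟨i, -, -, rfl⟩
  exact DeltaI_nonneg E i

lemma card_Nset_le_DeltaI_pow {x : Finset V} {n : ℕ} (h0 : 0 < x.card) (hn : 0 < n) :
    ((Nset E x n).card : ℝ) ≤ DeltaI E (x.card + n) ^ n := by
  have h := dDeg_le_DeltaI E h0 (Nat.lt_add_of_pos_right hn)
  rw [Nat.add_sub_cancel_left] at h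
  calc ((Nset E x n).card : ℝ) = dDeg E x n ^ n := by
        rw [dDeg, one_div, Real.rpow_inv_natCast_pow (Nat.cast_nonneg _) hn.ne']
    _ ≤ _ := pow_le_pow_left₀ (dDeg_nonneg E x n) h n

/-- Double counting of the pairs `(Y, W)` with `x ⊆ Y`, `|Y| = |x| + m` and `W ∈ N_j(X ∪ Y)`
through the set `(Y ∪ W) \ x ∈ N_{j+m}(X ∪ x)`. -/
lemma sum_card_Nset_union_le (F : Finset (Finset V)) (X x : Finset V) (j m : ℕ)
    (hF : ∀ Y ∈ F, x ⊆ Y ∧ X ∩ Y = ∅ ∧ Y.card = x.card + m) :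
    ∑ Y ∈ F, (Nset E (X ∪ Y) j).card ≤ (Nset E (X ∪ x) (j + m)).card * (j + m).choose j := by
  have hR : ((Nset E (X ∪ x) (j + m)).sigma fun Z => Z.powersetCard j).card
      = (Nset E (X ∪ x) (j + m)).card * (j + m).choose j := by
    rw [card_sigma, sum_const_nat]
    intro Z hZ
    rw [card_powersetCard, (mem_Nset.1 hZ).2.2]
  rw [← hR, ← card_sigma]
  refine card_le_card_of_injOn (fun q => ⟨(q.1 ∪ q.2) \ x, q.2⟩) ?_ ?_
  · rintro ⟨Y, W⟩ hq
    simp only [coe_sigma, Set.mem_sigma_iff, mem_coe, mem_Nset] at hq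
    obtain ⟨hY, hE, hdisj, hW⟩ := hq
    obtain ⟨hxY, hXY, hc⟩ := hF Y hY
    simp only [coe_sigma, Set.mem_sigma_iff, mem_coe, mem_Nset, mem_powersetCard]
    have hYW : Disjoint Y W := by
      rw [← disjoint_iff_inter_eq_empty] at hdisj
      exact hdisj.mono_left subset_union_right
    refine ⟨⟨?_, ?_, ?_⟩, ?_, hW⟩
    · convert hE using 1
      grind
    · grind
    · rw [card_sdiff_of_subset (hxY.trans subset_union_left), card_union_of_disjoint hYW]
      lia
    · exact subset_sdiff.2 ⟨subset_union_right, hYW.symm.mono_right hxY⟩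
  · rintro ⟨Y, W⟩ hq ⟨Y', W'⟩ hq' h
    simp only [coe_sigma, Set.mem_sigma_iff, mem_coe, mem_Nset] at hq hq'
    have hxY := (hF Y hq.1).1
    have hxY' := (hF Y' hq'.1).1
    simp only [Sigma.mk.injEq, heq_eq_eq] at h
    obtain ⟨h, rfl⟩ := h
    have hYW := hq.2.2.1
    have hYW' := hq'.2.2.1
    have : Y = Y' := by
      ext a
      have h1 := Finset.ext_iff.1 h a
      have h2 := Finset.ext_iff.1 hYW a
      have h3 := Finset.ext_iff.1 hYW' a
      have h4 := @hxY a
      have h5 := @hxY' a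
      simp only [mem_sdiff, mem_union, mem_inter, notMem_empty, iff_false] at h1 h2 h3
      tauto
    rw [this]

lemma choose_mul_pow_mul_pow_le {a b : ℝ} (ha : 0 ≤ a) (hab : a ≤ b) {j m d : ℕ}
    (hd : j + m ≤ d) :
    a ^ (j + m) * ((j + m).choose j : ℝ) * (1 / (2 ^ (d + 1) * b)) ^ m ≤ a ^ j := by
  have hb := ha.trans hab
  have hchoose : ((j + m).choose j : ℝ) ≤ (2 ^ (d + 1)) ^ m := by
    rcases Nat.eq_zero_or_pos m with rfl | hm
    · simp
    · have h1 : (j + m).choose j ≤ 2 ^ (j + m) := Nat.choose_le_two_pow _ _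
      have h2 : 2 ^ (j + m) ≤ (2 ^ (d + 1)) ^ m := by
        rw [← pow_mul]
        exact Nat.pow_le_pow_right two_pos (by nlinarith)
      exact_mod_cast h1.trans h2
  have hdiv : a / b ≤ 1 := div_le_one_of_le₀ hab hb
  calc a ^ (j + m) * ((j + m).choose j : ℝ) * (1 / (2 ^ (d + 1) * b)) ^ m
      ≤ a ^ (j + m) * (2 ^ (d + 1)) ^ m * (1 / (2 ^ (d + 1) * b)) ^ m := by gcongr
    _ = a ^ j * (a / b) ^ m := by
        rw [pow_add, mul_assoc, mul_assoc, ← mul_pow, ← mul_pow]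
        congr 2
        field_simp
    _ ≤ a ^ j := mul_le_of_le_one_right (pow_nonneg ha j) (pow_le_one₀ (by positivity) hdiv)

end Aux

/-- Lemma 3 in Kelsen: for a hypergraph `H` of dimension `d ≥ 2`, nonempty
`X ⊆ V` and `1 ≤ j < k ≤ d − |X|`, the weighted hypergraph `H'` with edge set
`X_{j,k} = {Y : |Y| = k−j, Y ⊆ Z for some Z ∈ N_k(X,H)}` and weights
`w'(Y) = |N_j(X ∪ Y,H)|` satisfies `D(H',w',p) ≤ (Δ_{|X|+k}(H))^j`, where
`p = 1/(2^(d+1)·Δ(H))`. -/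
theorem stmt2 {V : Type} [Fintype V] [DecidableEq V]
    (E : Finset (Finset V)) (d : ℕ)
    (hEne : ∀ e ∈ E, e.Nonempty)
    (hd : 2 ≤ d)
    (hdim : (∀ e ∈ E, e.card ≤ d) ∧ ∃ e ∈ E, e.card = d)
    (X : Finset V) (hX : X.Nonempty)
    (j k : ℕ) (hj : 1 ≤ j) (hjk : j < k) (hk : X.card + k ≤ d) :
    Dval
        (Finset.univ.filter (fun Y : Finset V =>
          Y.card = k - j ∧ ∃ Z ∈ Nset E X k, Y ⊆ Z))
        (fun Y => ((Nset E (X ∪ Y) j).card : ℝ))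
        (1 / (2 ^ (d + 1) * Delta E d))
      ≤ (DeltaI E (X.card + k)) ^ j := by
  refine Finset.sup'_le _ _ fun x _ => ?_
  have hΔ := DeltaI_nonneg E (X.card + k)
  unfold Pval
  set F := {e ∈ (Finset.univ.filter (fun Y : Finset V =>
    Y.card = k - j ∧ ∃ Z ∈ Nset E X k, Y ⊆ Z)) | x ⊆ e} with hF
  have hmem : ∀ Y ∈ F, x ⊆ Y ∧ X ∩ Y = ∅ ∧ Y.card = k - j := by
    intro Y hY
    simp only [hF, mem_filter, mem_univ, true_and] at hY
    obtain ⟨⟨hc, Z, hZ, hYZ⟩, hxY⟩ := hY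
    refine ⟨hxY, subset_empty.1 ?_, hc⟩
    rw [← (mem_Nset.1 hZ).2.1]
    exact inter_subset_inter_left hYZ
  rcases F.eq_empty_or_nonempty with h | ⟨Y₀, hY₀⟩
  · rw [h, sum_empty]
    positivity
  obtain ⟨hxY₀, hXY₀, hc₀⟩ := hmem Y₀ hY₀
  have hXx : Disjoint X x := (disjoint_iff_inter_eq_empty.2 hXY₀).mono_right hxY₀
  obtain ⟨m, hm⟩ := Nat.exists_eq_add_of_le (card_le_card hxY₀)
  have hcard : (X ∪ x).card + (j + m) = X.card + k := by
    rw [card_union_of_disjoint hXx]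
    lia
  have hcount := sum_card_Nset_union_le E F X x j m fun Y hY =>
    ⟨(hmem Y hY).1, (hmem Y hY).2.1, by rw [(hmem Y hY).2.2, ← hc₀, hm]⟩
  have hN := card_Nset_le_DeltaI_pow E (x := X ∪ x) (n := j + m)
    (card_pos.2 (hX.mono subset_union_left)) (by lia)
  rw [hcard] at hN
  have hX' := hX.card_pos
  have hp : 0 ≤ 1 / (2 ^ (d + 1) * Delta E d) := by
    have := Delta_nonneg E d
    positivity
  calc ∑ Y ∈ F, ((Nset E (X ∪ Y) j).card : ℝ)
          * (1 / (2 ^ (d + 1) * Delta E d)) ^ (Y.card - x.card)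
      = (∑ Y ∈ F, (Nset E (X ∪ Y) j).card : ℕ) * (1 / (2 ^ (d + 1) * Delta E d)) ^ m := by
        rw [Nat.cast_sum, sum_mul]
        refine sum_congr rfl fun Y hY => ?_
        rw [(hmem Y hY).2.2, ← hc₀, hm, Nat.add_sub_cancel_left]
    _ ≤ ((Nset E (X ∪ x) (j + m)).card * (j + m).choose j : ℕ)
          * (1 / (2 ^ (d + 1) * Delta E d)) ^ m := by gcongr
    _ ≤ DeltaI E (X.card + k) ^ (j + m) * ((j + m).choose j : ℝ)
          * (1 / (2 ^ (d + 1) * Delta E d)) ^ m := by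
        push_cast
        gcongr
    _ ≤ DeltaI E (X.card + k) ^ j :=
        choose_mul_pow_mul_pow_le hΔ (DeltaI_le_Delta E (by lia) hk) (by lia)
end

section
/- Let H = (V,E) be a hypergraph and let V' ⊆ V. Let I' be a maximal independent set of the hypergraph H' = (V', E') where E' = {e ∈ E : e ⊆ V'}. Let E'' = {e \ I' : e ∈ E and e ∩ (V' \ I') = ∅} and let I'' be a maximal independent set of the hypergraph H'' = (V \ V', E''). Then I' ∪ I'' is a maximal independent set of H. -/
open Finset

variable {α : Type} [DecidableEq α]

/-- `I` is independent in the hypergraph with edge set `E`: it contains no edge. -/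
def IsIndep (E : Finset (Finset α)) (I : Finset α) : Prop :=
  ∀ e ∈ E, ¬ e ⊆ I

/-- `I` is a maximal independent set of the hypergraph with vertex set `Vs` and
edge set `E`: it is an independent subset of `Vs` not properly contained in any
other independent subset of `Vs`. -/
def IsMaxIndep (Vs : Finset α) (E : Finset (Finset α)) (I : Finset α) : Prop :=
  I ⊆ Vs ∧ IsIndep E I ∧ ∀ J : Finset α, J ⊆ Vs → IsIndep E J → I ⊆ J → J = I

/-- if `I'` is an MIS of `H' = (V', {e ∈ E : e ⊆ V'})` and `I''` is an MIS of
`H'' = (V \ V', {e \ I' : e ∈ E, e ∩ (V' \ I') = ∅})`, then `I' ∪ I''` is an MIS of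
`H = (V, E)`. -/
theorem stmt6 (Vs : Finset α) (E : Finset (Finset α))
    (hE : ∀ e ∈ E, e.Nonempty ∧ e ⊆ Vs)
    (V' : Finset α) (hV' : V' ⊆ Vs)
    (I' : Finset α)
    (hI' : IsMaxIndep V' (E.filter (fun e => e ⊆ V')) I')
    (I'' : Finset α)
    (hI'' : IsMaxIndep (Vs \ V')
      ((E.filter (fun e => e ∩ (V' \ I') = ∅)).image (fun e => e \ I')) I'') :
    IsMaxIndep Vs E (I' ∪ I'') := by
  obtain ⟨hI'V, hI'ind, hI'max⟩ := hI'
  obtain ⟨hI''V, hI''ind, hI''max⟩ := hI''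
  refine ⟨union_subset (hI'V.trans hV') (hI''V.trans sdiff_subset), ?_, ?_⟩
  · intro e he hsub
    refine hI''ind (e \ I') (mem_image_of_mem _ (mem_filter.2 ⟨he, ?_⟩)) ?_
    · ext x
      have h1 := @hsub x
      have h2 := @hI''V x
      simp only [mem_union, mem_sdiff, mem_inter, notMem_empty] at *
      tauto
    · intro x hx
      have h1 := @hsub x
      simp only [mem_union, mem_sdiff] at *
      tauto
  · intro J hJV hJ hIJ
    have hin : J ∩ V' = I' := by
      refine hI'max _ inter_subset_right ?_
        (subset_inter (subset_union_left.trans hIJ) hI'V)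
      intro e he hsub
      exact hJ e (mem_filter.1 he).1 (hsub.trans inter_subset_left)
    have hout : J \ V' = I'' := by
      refine hI''max _ (sdiff_subset_sdiff hJV le_rfl) ?_ ?_
      · intro f hf hsub
        obtain ⟨e, he, rfl⟩ := mem_image.1 hf
        refine hJ e (mem_filter.1 he).1 fun x hx => ?_
        by_cases hxI : x ∈ I'
        · exact hIJ (mem_union_left _ hxI)
        · exact (mem_sdiff.1 (hsub (mem_sdiff.2 ⟨hx, hxI⟩))).1
      · intro x hx
        exact mem_sdiff.2 ⟨hIJ (mem_union_right _ hx), (mem_sdiff.1 (hI''V hx)).2⟩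
    rw [← hin, ← hout, union_comm, sdiff_union_inter]
end

section
/- There is a threshold n₀ such that for every real n ≥ n₀ and all integers d, j with 3 ≤ d ≤ (ln ln n)/(4 ln ln ln n) and 2 ≤ j < d, we have 2^{d(d+1)} · Σ_{k=j+1}^{d} (ln n)^{2^{k−j+1} + 2 − d² + F(j) − F(k−1)} ≤ 2/(ln n + 2 ln ln n), where F is defined by F(1) = 0 and F(i) = i·F(i−1) + d² for i ≥ 2. -/
open Finset

/-- `F d` from the paper: `F 1 = 0`, `F i = i * F (i-1) + d^2` for `i ≥ 2`. -/
def F (d : ℕ) : ℕ → ℕ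
  | 0 => 0
  | 1 => 0
  | (i + 2) => (i + 2) * F d (i + 1) + d ^ 2

lemma F_succ (d : ℕ) {i : ℕ} (hi : 1 ≤ i) : F d (i + 1) = (i + 1) * F d i + d ^ 2 := by
  obtain ⟨i, rfl⟩ := Nat.exists_eq_add_of_le' hi
  rfl

lemma two_pow_le_F {d i : ℕ} (hd : 2 ≤ d) (hi : 2 ≤ i) : 2 ^ i ≤ F d i := by
  induction i, hi using Nat.le_induction with
  | base =>
    rw [F_succ d le_rfl]
    nlinarith
  | succ i hi ih =>
    rw [F_succ d (by omega), pow_succ]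
    nlinarith

lemma two_pow_add_F_le {d j : ℕ} (hd : 2 ≤ d) (hj : 2 ≤ j) (m : ℕ) :
    2 ^ (m + 2) + F d j ≤ 4 + F d (j + m) := by
  induction m with
  | zero => simp
  | succ m ih =>
    have hF : 2 ^ (m + 2) ≤ F d (j + m) :=
      (Nat.pow_le_pow_right two_pos (by omega)).trans (two_pow_le_F hd (by omega))
    rw [← add_assoc, F_succ d (by omega), show m + 1 + 2 = m + 2 + 1 by rfl, pow_succ]
    nlinarith [Nat.zero_le (d ^ 2), Nat.mul_le_mul_right (F d (j + m)) (show 2 ≤ j + m by omega)]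

lemma exponent_le {d j k : ℕ} (hd : 2 ≤ d) (hj : 2 ≤ j) (hk : j + 1 ≤ k) :
    (2 : ℤ) ^ (k - j + 1) + 2 - (d : ℤ) ^ 2 + (F d j : ℤ) - (F d (k - 1) : ℤ)
      ≤ 6 - (d : ℤ) ^ 2 := by
  obtain ⟨m, rfl⟩ := Nat.exists_eq_add_of_le hk
  have h := two_pow_add_F_le hd hj m
  rw [show j + 1 + m - j + 1 = m + 2 by omega, show j + 1 + m - 1 = j + m by omega]
  zify at h
  linarith

lemma two_mul_log_le {x : ℝ} (hx : 0 < x) : 2 * Real.log x ≤ x := by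
  have h := Real.log_le_sub_one_of_pos (half_pos hx)
  rw [Real.log_div hx.ne' two_ne_zero] at h
  linarith [Real.log_two_lt_d9]

lemma two_pow_mul_le_pow {x : ℝ} (hx : 256 ≤ x) {d : ℕ} (hd : 3 ≤ d) :
    (2 : ℝ) ^ (d * (d + 1)) * d ≤ x ^ (d ^ 2 - 7) := by
  have hexp : d * (d + 1) + d ≤ 8 * (d ^ 2 - 7) := by
    have h : 7 ≤ d ^ 2 := by nlinarith
    zify [h]
    nlinarith
  calc (2 : ℝ) ^ (d * (d + 1)) * d
      ≤ 2 ^ (d * (d + 1)) * 2 ^ d := by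
        gcongr
        exact_mod_cast Nat.lt_two_pow_self.le
    _ = 2 ^ (d * (d + 1) + d) := (pow_add _ _ _).symm
    _ ≤ 2 ^ (8 * (d ^ 2 - 7)) := pow_le_pow_right₀ one_le_two hexp
    _ = 256 ^ (d ^ 2 - 7) := by rw [pow_mul]; norm_num
    _ ≤ x ^ (d ^ 2 - 7) := by gcongr

/-- there is a threshold `n₀` such that for all real `n ≥ n₀` and integers
`d, j` with `3 ≤ d ≤ (ln ln n)/(4 ln ln ln n)` and `2 ≤ j < d`,
`2^(d(d+1)) · Σ_{k=j+1}^{d} (ln n)^(2^(k−j+1) + 2 − d² + F(j) − F(k−1))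
  ≤ 2/(ln n + 2 ln ln n)`. -/
theorem stmt8 :
    ∃ n₀ : ℝ, ∀ n : ℝ, n₀ ≤ n → ∀ d j : ℕ, 3 ≤ d →
      (d : ℝ) ≤ Real.log (Real.log n) / (4 * Real.log (Real.log (Real.log n))) →
      2 ≤ j → j < d →
      (2 : ℝ) ^ (d * (d + 1)) *
          ∑ k ∈ Finset.Icc (j + 1) d,
            (Real.log n) ^
              ((2 : ℤ) ^ (k - j + 1) + 2 - (d : ℤ) ^ 2 + (F d j : ℤ) - (F d (k - 1) : ℤ))
        ≤ 2 / (Real.log n + 2 * Real.log (Real.log n)) := by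
  refine ⟨Real.exp 256, fun n hn d j hd _ hj _ => ?_⟩
  have hx : 256 ≤ Real.log n :=
    (Real.le_log_iff_exp_le ((Real.exp_pos _).trans_le hn)).2 hn
  generalize Real.log n = x at hx
  have hx0 : 0 < x := by linarith
  have hlog : 0 ≤ Real.log x := Real.log_nonneg (by linarith)
  have hsum : ∑ k ∈ Finset.Icc (j + 1) d,
      x ^ ((2 : ℤ) ^ (k - j + 1) + 2 - (d : ℤ) ^ 2 + (F d j : ℤ) - (F d (k - 1) : ℤ))
        ≤ d * x ^ (6 - (d : ℤ) ^ 2) := by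
    refine (Finset.sum_le_card_nsmul _ _ (x ^ (6 - (d : ℤ) ^ 2)) fun k hk =>
      zpow_le_zpow_right₀ (by linarith)
        (exponent_le (by omega) hj (Finset.mem_Icc.1 hk).1)).trans ?_
    rw [nsmul_eq_mul]
    gcongr
    simp
  have hd7 : 7 ≤ d ^ 2 := by nlinarith
  calc _ ≤ (2 : ℝ) ^ (d * (d + 1)) * (d * x ^ (6 - (d : ℤ) ^ 2)) := by gcongr
    _ = (2 : ℝ) ^ (d * (d + 1)) * d * x ^ (6 - (d : ℤ) ^ 2) := by ring
    _ ≤ x ^ (d ^ 2 - 7) * x ^ (6 - (d : ℤ) ^ 2) := by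
        gcongr
        exact two_pow_mul_le_pow hx hd
    _ = x⁻¹ := by
        rw [← zpow_natCast, ← zpow_add₀ hx0.ne', ← zpow_neg_one]
        congr 1
        push_cast [hd7]
        ring
    _ = 2 / (x + x) := by
        field_simp
        ring
    _ ≤ 2 / (x + 2 * Real.log x) := by
        gcongr
        exact two_mul_log_le hx0
end
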